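/- Let p ≥ 5 be a prime, N ≥ 0 an integer, l a positive integer with p^N | l, and s a positive integer with s ≥ ⌈(N+2)/(p−2)⌉. Set m = s(p−1) and n = m + l(p−1). Then, in ℚ[c_1,…,c_n], B̂_n/n ≡ c_{p−1}^l·(B̂_m/m) + (τ_{σ(n)} − τ_{σ(m)})·c_{p−1}^{l+s} (mod p^{N+1}ℤ_p[c_1,…,c_n]), where σ(n) denotes the partition of n all of whose parts equal p−1 (it has n/(p−1) parts) and likewise σ(m) for m. -/

import Mathlib

open Finsupp MvPolynomial

noncomputable section

/-- weight of a partition (given as the multiplicity function of its parts) -/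
def wt (u : ℕ →₀ ℕ) : ℕ := u.sum fun i m => i * m

/-- degree (number of parts) -/
def deg (u : ℕ →₀ ℕ) : ℕ := u.sum fun _ m => m

/-- γ_u = Π_i (i+1)^{u_i} (u_i)! -/
def gam (u : ℕ →₀ ℕ) : ℕ := u.prod fun i m => (i + 1) ^ m * m.factorial

/-- τ_u = (−1)^{d(u)−1} (w(u)+d(u)−2)! / γ_u -/
def tau (u : ℕ →₀ ℕ) : ℚ :=
  (-1 : ℚ) ^ (deg u - 1) * (Nat.factorial (wt u + deg u - 2) : ℚ) / (gam u : ℚ)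

/-- p-adic valuation on ℚ with v_p(0) = ⊤ -/
def pval (p : ℕ) (x : ℚ) : WithTop ℤ :=
  if x = 0 then ⊤ else ((padicValRat p x : ℤ) : WithTop ℤ)

/-- divided universal Bernoulli number B̂_n/n = Σ_{w(u)=n} τ_u c^u, as a
multivariate polynomial in the variables c_1, c_2, … (variable i is c_i). -/
def divB (n : ℕ) : MvPolynomial ℕ ℚ :=
  ∑ P : n.Partition, (tau P.parts.toFinsupp) • MvPolynomial.monomial P.parts.toFinsupp (1 : ℚ)

/-- F ≡ G (mod p^t ℤ_p[c_1,…]) : every coefficient of F − G has v_p ≥ t -/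
def PCong (p t : ℕ) (F G : MvPolynomial ℕ ℚ) : Prop :=
  ∀ u : ℕ →₀ ℕ, ((t : ℤ) : WithTop ℤ) ≤ pval p (MvPolynomial.coeff u (F - G))

/-- The product of the positive integers up to `A` that are not divisible by `p`. -/
def primeToFactorial (p A : ℕ) : ℕ :=
  ∏ j ∈ Finset.range A, if p ∣ j + 1 then 1 else j + 1

lemma factorial_eq_pow_mul_primeToFactorial {p : ℕ} (hp : 0 < p) (A : ℕ) :
    A.factorial = p ^ (A / p) * (A / p).factorial * primeToFactorial p A := by
  induction A with
  | zero => simp [primeToFactorial]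
  | succ A ih =>
    have hU : primeToFactorial p (A + 1) =
        primeToFactorial p A * if p ∣ A + 1 then 1 else A + 1 := by
      simp [primeToFactorial, Finset.prod_range_succ]
    rw [hU, Nat.factorial_succ, ih, Nat.succ_div]
    split_ifs with h
    · have h2 : A + 1 = p * (A / p + 1) := by
        obtain ⟨c, hc⟩ := h
        have : (A + 1) / p = A / p + 1 := by rw [Nat.succ_div, if_pos ⟨c, hc⟩]
        rw [hc, Nat.mul_div_cancel_left _ hp] at this
        rw [hc, this]
      rw [pow_succ, Nat.factorial_succ]
      calc (A + 1) * (p ^ (A / p) * (A / p).factorial * primeToFactorial p A)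
          = (p * (A / p + 1)) * (p ^ (A / p) * (A / p).factorial * primeToFactorial p A) := by
            rw [← h2]
        _ = _ := by ring
    · simp only [add_zero]; ring

/-- Gauss's generalization of Wilson's theorem, for odd prime powers. -/
lemma prod_units_zmod_prime_pow {p : ℕ} (hp : p.Prime) (hp2 : 2 < p) {K : ℕ} (hK : 0 < K) :
    haveI : NeZero (p ^ K) := ⟨(pow_pos hp.pos K).ne'⟩
    ∏ x : (ZMod (p ^ K))ˣ, x = -1 := by
  have : NeZero (p ^ K) := ⟨(pow_pos hp.pos K).ne'⟩
  have hlt : 2 < p ^ K := lt_of_lt_of_le hp2 (Nat.le_self_pow hK.ne' p)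
  have : Fact (2 < p ^ K) := ⟨hlt⟩
  have hne : (-1 : (ZMod (p ^ K))ˣ) ≠ 1 := by
    intro h
    exact ZMod.neg_one_ne_one (congrArg Units.val h)
  have hsq : ∀ x : (ZMod (p ^ K))ˣ, x⁻¹ = x → x = 1 ∨ x = -1 := by
    intro x hx
    have h1 : (x : ZMod (p ^ K)) * x = 1 := by
      conv_lhs => rw [← hx]
      rw [hx]
      conv_lhs => arg 1; rw [← hx]
      exact x.inv_mul
    obtain ⟨a, ha⟩ := ZMod.intCast_surjective (x : ZMod (p ^ K))
    have h2 : ((p : ℤ) ^ K) ∣ (a - 1) * (a + 1) := by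
      have : (((a - 1) * (a + 1) : ℤ) : ZMod (p ^ K)) = 0 := by
        push_cast; rw [ha]; linear_combination h1
      have := (ZMod.intCast_zmod_eq_zero_iff_dvd _ _).1 this
      exact_mod_cast this
    have hpi : Prime (p : ℤ) := Nat.prime_iff_prime_int.1 hp
    by_cases h3 : (p : ℤ) ∣ a - 1
    · left
      have h4 : ¬ (p : ℤ) ∣ a + 1 := by
        intro h4
        have h5 := dvd_sub h4 h3
        rw [show a + 1 - (a - 1) = 2 by ring] at h5
        have := Int.le_of_dvd (by norm_num) h5
        omega
      have h5 := hpi.pow_dvd_of_dvd_mul_right K h4 h2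
      have h6 : ((a - 1 : ℤ) : ZMod (p ^ K)) = 0 :=
        (ZMod.intCast_zmod_eq_zero_iff_dvd _ _).2 (by exact_mod_cast h5)
      ext
      push_cast at h6 ⊢
      rw [← ha]; linear_combination h6
    · right
      have h5 := hpi.pow_dvd_of_dvd_mul_left K h3 h2
      have h6 : ((a + 1 : ℤ) : ZMod (p ^ K)) = 0 :=
        (ZMod.intCast_zmod_eq_zero_iff_dvd _ _).2 (by exact_mod_cast h5)
      ext
      push_cast at h6 ⊢
      rw [← ha]; linear_combination h6
  classical
  rw [← Finset.mul_prod_erase Finset.univ (fun x => x) (Finset.mem_univ (-1))]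
  rw [Finset.prod_involution (fun x _ => x⁻¹)]
  · simp
  · simp
  · intro x hx h1 h2
    rcases hsq x h2 with h | h
    · exact h1 h
    · exact (Finset.mem_erase.1 hx).1 h
  · intro x hx
    refine Finset.mem_erase.2 ⟨fun h => (Finset.mem_erase.1 hx).1 ?_, Finset.mem_univ _⟩
    rw [← inv_inv x, h]; simp
  · simp

lemma primeToFactorial_add_prime_pow {p : ℕ} (hp : p.Prime) (hp2 : 2 < p) {K : ℕ} (hK : 0 < K)
    (A : ℕ) : (primeToFactorial p (A + p ^ K) : ZMod (p ^ K)) = -primeToFactorial p A := by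
  have : NeZero (p ^ K) := ⟨(pow_pos hp.pos K).ne'⟩
  set f : ℕ → ZMod (p ^ K) := fun j => if p ∣ j then 1 else j with hf
  have hper : ∀ j, f (j + p ^ K) = f j := by
    intro j
    have h1 : p ∣ j + p ^ K ↔ p ∣ j := (Nat.dvd_add_left (dvd_pow_self p hK.ne'))
    have h2 : ((j + p ^ K : ℕ) : ZMod (p ^ K)) = j := by
      rw [Nat.cast_add, ZMod.natCast_self, add_zero]
    simp only [hf, h1, h2]
  have hunit : ∀ j, IsUnit (f j) := by
    intro j
    simp only [hf]
    split_ifs with h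
    · exact isUnit_one
    · exact (ZMod.isUnit_iff_coprime _ _).2
        (Nat.Coprime.pow_right _ ((hp.coprime_iff_not_dvd.2 h).symm))
  have hwin : ∀ A, ∏ i ∈ Finset.range (p ^ K), f (A + i) = ∏ i ∈ Finset.range (p ^ K), f i := by
    intro A
    induction A with
    | zero => simp
    | succ A ih =>
      rw [← ih]
      have h1 := Finset.prod_range_succ (fun i => f (A + i)) (p ^ K)
      rw [Finset.prod_range_succ', hper] at h1
      have := (hunit A).mul_right_cancel h1
      rw [← this]
      exact Finset.prod_congr rfl fun i _ => by congr 1; ring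
  have hW : ∏ i ∈ Finset.range (p ^ K), f i = -1 := by
    have h0 := prod_units_zmod_prime_pow hp hp2 hK
    have h0' := congrArg (Units.coeHom (ZMod (p ^ K))) h0
    rw [map_prod] at h0'
    simp only [Units.coeHom_apply, Units.val_neg, Units.val_one] at h0'
    rw [← h0']
    symm
    have hfil : ∏ i ∈ Finset.range (p ^ K), f i =
        ∏ i ∈ (Finset.range (p ^ K)).filter (fun j => ¬ p ∣ j), (i : ZMod (p ^ K)) := by
      rw [Finset.prod_filter]
      exact Finset.prod_congr rfl fun i _ => by simp only [hf]; split_ifs <;> simp_all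
    rw [hfil]
    refine Finset.prod_bij (fun x _ => ((x : (ZMod (p ^ K))ˣ) : ZMod (p ^ K)).val) ?_ ?_ ?_ ?_
    · intro x _
      refine Finset.mem_filter.2 ⟨Finset.mem_range.2 (ZMod.val_lt _), fun h => ?_⟩
      have := ZMod.val_coe_unit_coprime x
      exact hp.one_lt.ne' (Nat.dvd_one.1 (this ▸ Nat.dvd_gcd h (dvd_pow_self p hK.ne')))
    · intro x _ y _ h
      exact Units.ext (ZMod.val_injective _ h)
    · intro j hj
      obtain ⟨h1, h2⟩ := Finset.mem_filter.1 hj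
      have h3 : IsUnit (j : ZMod (p ^ K)) := (ZMod.isUnit_iff_coprime _ _).2
        (Nat.Coprime.pow_right _ ((hp.coprime_iff_not_dvd.2 h2).symm))
      refine ⟨h3.unit, Finset.mem_univ _, ?_⟩
      rw [IsUnit.unit_spec]
      exact ZMod.val_cast_of_lt (Finset.mem_range.1 h1)
    · intro x _
      simp
  have hcast : ∀ B, (primeToFactorial p B : ZMod (p ^ K)) = ∏ j ∈ Finset.range B, f (j + 1) := by
    intro B
    simp [primeToFactorial, hf]
  rw [hcast, hcast, Finset.prod_range_add, ← mul_neg_one, ← hW, ← hwin (A + 1)]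
  congr 1
  exact Finset.prod_congr rfl fun i _ => by congr 1; ring

lemma primeToFactorial_add_mul {p : ℕ} (hp : p.Prime) (hp2 : 2 < p) {N l : ℕ}
    (hl : p ^ N ∣ l) (A : ℕ) :
    ((p : ℤ) ^ (N + 1)) ∣ (-1) ^ l * primeToFactorial p (A + l * p) - primeToFactorial p A := by
  obtain ⟨c, rfl⟩ := hl
  have hodd : Odd (p ^ N) := (hp.odd_of_ne_two (by omega)).pow
  have h1 : ∀ c : ℕ, (primeToFactorial p (A + c * p ^ (N + 1)) : ZMod (p ^ (N + 1))) =
      (-1) ^ c * primeToFactorial p A := by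
    intro c
    induction c with
    | zero => simp
    | succ c ih =>
      rw [show A + (c + 1) * p ^ (N + 1) = A + c * p ^ (N + 1) + p ^ (N + 1) by ring,
        primeToFactorial_add_prime_pow hp hp2 N.succ_pos, ih]
      ring
  have h2 : ((((-1) ^ (p ^ N * c) * primeToFactorial p (A + p ^ N * c * p)
      - primeToFactorial p A : ℤ)) : ZMod (p ^ (N + 1))) = 0 := by
    rw [show A + p ^ N * c * p = A + c * p ^ (N + 1) by ring]
    push_cast
    rw [h1, pow_mul, hodd.neg_one_pow, ← mul_assoc, ← mul_pow]
    simp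
  have := (ZMod.intCast_zmod_eq_zero_iff_dvd _ _).1 h2
  exact_mod_cast this

lemma ascFactorial_modEq (k l b : ℕ) :
    (k + l + 1).ascFactorial b ≡ (k + 1).ascFactorial b [MOD l] := by
  induction b with
  | zero => rfl
  | succ b ih =>
    rw [Nat.ascFactorial_succ, Nat.ascFactorial_succ]
    refine Nat.ModEq.mul ?_ ih
    rw [show k + l + 1 + b = (k + 1 + b) + l by ring]
    simp [Nat.ModEq]

lemma dvd_ascFactorial {k l b : ℕ} (h1 : k < l) (h2 : l ≤ k + b) :
    l ∣ (k + 1).ascFactorial b := by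
  rw [Nat.ascFactorial_eq_prod_range]
  have := Finset.dvd_prod_of_mem (fun i => k + 1 + i) (Finset.mem_range.2 (show l - k - 1 < b by omega))
  rwa [show k + 1 + (l - k - 1) = l by omega] at this

lemma padicValNat_finset_prod {ι : Type*} {p : ℕ} [Fact p.Prime] (S : Finset ι) (f : ι → ℕ)
    (hf : ∀ i ∈ S, f i ≠ 0) : padicValNat p (∏ i ∈ S, f i) = ∑ i ∈ S, padicValNat p (f i) := by
  classical
  induction S using Finset.induction_on with
  | empty => simp
  | insert a S ha ih =>
    rw [Finset.prod_insert ha, Finset.sum_insert ha, padicValNat.mul (hf a (by simp))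
      (Finset.prod_ne_zero_iff.2 fun i hi => hf i (by simp [hi])),
      ih fun i hi => hf i (by simp [hi])]

lemma padicValNat_pow_mul_factorial {p : ℕ} [Fact p.Prime] {x : ℕ} (hx : x ≠ 0) (y : ℕ) :
    padicValNat p (x ^ y * y.factorial) =
      y * padicValNat p x + padicValNat p y.factorial := by
  rw [padicValNat.mul (pow_ne_zero _ hx) (Nat.factorial_ne_zero _), padicValNat.pow]

/-- `x ≥ p + p (v_p(x) - 1) (p - 1)`. -/
lemma mul_padicValNat_le {p : ℕ} [hp : Fact p.Prime] {x : ℕ} (hx : x ≠ 0) :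
    p * (p - 1) * padicValNat p x ≤ x + p * (p - 2) := by
  obtain ⟨q, rfl⟩ : ∃ q, p = q + 2 := ⟨p - 2, by have := hp.out.two_le; omega⟩
  simp only [Nat.add_sub_cancel, show q + 2 - 1 = q + 1 by omega]
  rcases h : padicValNat (q + 2) x with _ | v
  · simp
  · have h1 : (q + 2) ^ (v + 1) ∣ x := h ▸ pow_padicValNat_dvd
    have h2 := Nat.le_of_dvd (Nat.pos_of_ne_zero hx) h1
    have h3 := one_add_mul_le_pow (a := ((q : ℤ) + 1)) (by linarith [Int.natCast_nonneg q]) v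
    have h3' : 1 + v * (q + 1) ≤ (q + 2) ^ v := by
      have : ((1 + v * (q + 1) : ℕ) : ℤ) ≤ ((q + 2) ^ v : ℕ) := by
        push_cast; rw [show (q : ℤ) + 2 = 1 + (q + 1) by ring]; exact h3
      exact_mod_cast this
    rw [pow_succ] at h2
    nlinarith [Nat.mul_le_mul_right (q + 2) h3']

lemma padicValNat_part_bound {p : ℕ} [hp : Fact p.Prime] (hp5 : 5 ≤ p) {x y : ℕ} (hx : 2 ≤ x)
    (hxp : x ≠ p) (hy : y ≠ 0) (hg : padicValNat p (x ^ y * y.factorial) ≠ 0) :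
    p * (padicValNat p (x ^ y * y.factorial) + 1) + 2 ≤ x * y ∨
      (p * (padicValNat p (x ^ y * y.factorial) + 1) = x * y ∧
        (x = 2 * p ∧ y = 1 ∨ x = 2 ∧ y = p)) := by
  rw [padicValNat_pow_mul_factorial (by omega)] at hg ⊢
  have hv := mul_padicValNat_le (p := p) (x := x) (by omega)
  have hh := sub_one_mul_padicValNat_factorial_lt_of_ne_zero (p := p) hy
  have hdvd : padicValNat p x ≠ 0 → p ∣ x := fun h => dvd_of_one_le_padicValNat (by omega)
  generalize padicValNat p x = v at *
  generalize padicValNat p y.factorial = h at *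
  obtain ⟨q, rfl⟩ : ∃ q, p = q + 5 := ⟨p - 5, by omega⟩
  simp only [show q + 5 - 1 = q + 4 by omega, show q + 5 - 2 = q + 3 by omega] at *
  rcases v with _ | _ | v
  · simp only [mul_zero, zero_add] at hg ⊢
    rcases h with _ | _ | h
    · omega
    · simp only [zero_add, mul_one] at *
      rcases Nat.lt_or_ge 2 x with h2 | h2
      · left; nlinarith
      · obtain rfl : x = 2 := by omega
        rcases Nat.lt_or_ge (q + 5) y with h3 | h3
        · left; nlinarith
        · right; omega
    · left; nlinarith
  · obtain ⟨c, rfl⟩ := hdvd (by simp)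
    have hc : 2 ≤ c := by
      rcases c with _ | _ | c
      · omega
      · omega
      · omega
    simp only [zero_add, mul_one] at *
    rcases Nat.lt_or_ge 1 y with h3 | h3
    · left
      have : h + 1 < y := by
        rcases h with _ | h
        · omega
        · nlinarith
      nlinarith [Nat.mul_le_mul_left ((q + 5) * y) hc]
    · obtain rfl : y = 1 := by omega
      obtain rfl : h = 0 := by
        rcases h with _ | h
        · rfl
        · nlinarith
      rcases Nat.lt_or_ge 2 c with h4 | h4
      · left; nlinarith
      · right
        obtain rfl : c = 2 := by omega
        refine ⟨by ring, Or.inl ⟨by ring, rfl⟩⟩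
  · left
    have h5 : (q + 5) * (4 * v + 5) ≤ x := by nlinarith [Nat.zero_le (q * (q + 5) * v), Nat.zero_le (q * (q + 5))]
    have h6 : y * (v + 2) + h + 2 ≤ (4 * v + 5) * y := by nlinarith [Nat.zero_le (q * h), Nat.pos_of_ne_zero hy, Nat.zero_le (v * y)]
    nlinarith [Nat.mul_le_mul_right y h5, Nat.mul_le_mul_left (q + 5) h6]

lemma le_pval_of_mul_eq {p : ℕ} [hp : Fact p.Prime] {x : ℚ} {D : ℕ} (hD : D ≠ 0) {Y : ℤ}
    (h : x * D = Y) {t : ℕ} (hY : (p : ℤ) ^ (t + padicValNat p D) ∣ Y) :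
    ((t : ℤ) : WithTop ℤ) ≤ pval p x := by
  unfold pval
  split_ifs with hx
  · exact le_top
  · have hDq : (D : ℚ) ≠ 0 := Nat.cast_ne_zero.2 hD
    have hY0 : Y ≠ 0 := by
      rintro rfl
      simp [hx, hDq] at h
    have h1 := padicValRat.mul (p := p) hx hDq
    rw [h, padicValRat.of_int, padicValRat.of_nat] at h1
    have h2 := ((padicValInt_dvd_iff _ _).1 hY).resolve_left hY0
    exact WithTop.coe_le_coe.2 (by omega)

lemma wt_add_deg (v : ℕ →₀ ℕ) : wt v + deg v = ∑ i ∈ v.support, (i + 1) * v i := by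
  simp only [wt, deg, Finsupp.sum, ← Finset.sum_add_distrib]
  exact Finset.sum_congr rfl fun i _ => by ring

lemma wt_add_single (v : ℕ →₀ ℕ) (i k : ℕ) : wt (v + single i k) = wt v + i * k := by
  unfold wt
  rw [Finsupp.sum_add_index' (by simp) (by intros; ring), Finsupp.sum_single_index (by simp)]

lemma deg_add_single (v : ℕ →₀ ℕ) (i k : ℕ) : deg (v + single i k) = deg v + k := by
  unfold deg
  rw [Finsupp.sum_add_index' (by simp) (by intros; ring), Finsupp.sum_single_index (by simp)]

lemma gam_add_single {v : ℕ →₀ ℕ} {i : ℕ} (hv : v i = 0) (k : ℕ) :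
    gam (v + single i k) = gam v * ((i + 1) ^ k * k.factorial) := by
  classical
  unfold gam
  rw [Finsupp.prod_add_index_of_disjoint, Finsupp.prod_single_index (by simp)]
  refine Finset.disjoint_left.2 fun j hj hj' => ?_
  obtain rfl : j = i := by simpa using Finsupp.support_single_subset hj'
  exact Finsupp.mem_support_iff.1 hj hv

lemma gam_ne_zero (v : ℕ →₀ ℕ) : gam v ≠ 0 :=
  Finset.prod_ne_zero_iff.2 fun _ _ =>
    mul_ne_zero (pow_ne_zero _ (Nat.succ_ne_zero _)) (Nat.factorial_ne_zero _)

lemma padicValNat_gam {p : ℕ} [Fact p.Prime] (v : ℕ →₀ ℕ) : padicValNat p (gam v) =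
    ∑ i ∈ v.support, padicValNat p ((i + 1) ^ v i * (v i).factorial) :=
  padicValNat_finset_prod _ _ fun _ _ =>
    mul_ne_zero (pow_ne_zero _ (Nat.succ_ne_zero _)) (Nat.factorial_ne_zero _)

lemma mul_padicValNat_part_add_two_le {p : ℕ} [hp : Fact p.Prime] (hp5 : 5 ≤ p) {x y : ℕ}
    (hx : 2 ≤ x) (hxp : x ≠ p) (hy : y ≠ 0) :
    p * padicValNat p (x ^ y * y.factorial) + 2 ≤ x * y := by
  by_cases hg : padicValNat p (x ^ y * y.factorial) = 0
  · rw [hg]; nlinarith [Nat.pos_of_ne_zero hy]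
  · rcases padicValNat_part_bound hp5 hx hxp hy hg with h | h <;> nlinarith

lemma part_ne {p i : ℕ} {v : ℕ →₀ ℕ} (hp : 0 < p) (h0 : v 0 = 0) (h1 : v (p - 1) = 0)
    (hi : i ∈ v.support) : 2 ≤ i + 1 ∧ i + 1 ≠ p ∧ v i ≠ 0 := by
  have h := Finsupp.mem_support_iff.1 hi
  refine ⟨?_, ?_, h⟩
  · rcases i with _ | i
    · exact absurd h0 h
    · omega
  · rintro rfl
    exact h h1

lemma sum_padicValNat_part_le {p : ℕ} [hp : Fact p.Prime] (hp5 : 5 ≤ p) {v : ℕ →₀ ℕ}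
    (h0 : v 0 = 0) (h1 : v (p - 1) = 0) {S : Finset ℕ} (hS : S ⊆ v.support) (hne : S.Nonempty) :
    p * ∑ i ∈ S, padicValNat p ((i + 1) ^ v i * (v i).factorial) + 2 ≤
      ∑ i ∈ S, (i + 1) * v i := by
  classical
  obtain ⟨j, hj⟩ := hne
  have hb : ∀ i ∈ S, p * padicValNat p ((i + 1) ^ v i * (v i).factorial) + 2 ≤ (i + 1) * v i := by
    intro i hi
    obtain ⟨h2, h3, h4⟩ := part_ne hp.out.pos h0 h1 (hS hi)
    exact mul_padicValNat_part_add_two_le hp5 h2 h3 h4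
  rw [← Finset.add_sum_erase S _ hj, ← Finset.add_sum_erase S _ hj, mul_add, Finset.mul_sum]
  have h3 : ∑ i ∈ S.erase j, p * padicValNat p ((i + 1) ^ v i * (v i).factorial) ≤
      ∑ i ∈ S.erase j, (i + 1) * v i :=
    Finset.sum_le_sum fun i hi => by have := hb i (Finset.mem_of_mem_erase hi); omega
  have h2 := hb j hj
  omega

lemma mul_padicValNat_gam_add_two_le {p : ℕ} [hp : Fact p.Prime] (hp5 : 5 ≤ p) {v : ℕ →₀ ℕ}
    (h0 : v 0 = 0) (h1 : v (p - 1) = 0) (hv : v ≠ 0) :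
    p * padicValNat p (gam v) + 2 ≤ wt v + deg v := by
  rw [padicValNat_gam, wt_add_deg]
  exact sum_padicValNat_part_le hp5 h0 h1 subset_rfl (Finsupp.support_nonempty_iff.2 hv)

lemma mul_padicValNat_gam_succ_add_two_le {p : ℕ} [hp : Fact p.Prime] (hp5 : 5 ≤ p)
    {v : ℕ →₀ ℕ} (h0 : v 0 = 0) (h1 : v (p - 1) = 0) (hw : p - 1 ∣ wt v)
    (he : p + 2 ≤ wt v + deg v) :
    p * (padicValNat p (gam v) + 1) + 2 ≤ wt v + deg v := by
  classical
  by_cases hg : padicValNat p (gam v) = 0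
  · rw [hg]; omega
  have hwt : wt v = ∑ i ∈ v.support, i * v i := rfl
  rw [padicValNat_gam] at hg ⊢
  rw [wt_add_deg] at he ⊢
  obtain ⟨j, hj, hgj⟩ := Finset.exists_ne_zero_of_sum_ne_zero hg
  obtain ⟨h2, h3, h4⟩ := part_ne hp.out.pos h0 h1 hj
  have hb := padicValNat_part_bound hp5 h2 h3 h4 hgj
  rw [← Finset.add_sum_erase _ _ hj] at hwt
  rw [← Finset.add_sum_erase _ _ hj, ← Finset.add_sum_erase _ _ hj]
  rcases (v.support.erase j).eq_empty_or_nonempty with hE | hE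
  · rw [hE] at hwt ⊢
    simp only [Finset.sum_empty, add_zero] at hwt ⊢
    rcases hb with hb | ⟨_, ⟨h5, h6⟩ | ⟨h5, h6⟩⟩
    · exact hb
    · exfalso
      rw [hwt, h6, mul_one] at hw
      have h7 : p - 1 ∣ j - 2 * (p - 1) := Nat.dvd_sub hw (Dvd.intro_left _ rfl)
      rw [show j - 2 * (p - 1) = 1 by omega] at h7
      have := Nat.dvd_one.1 h7
      omega
    · exfalso
      rw [hwt, h6, show j = 1 by omega, one_mul] at hw
      have h7 : p - 1 ∣ p - (p - 1) := Nat.dvd_sub hw dvd_rfl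
      rw [show p - (p - 1) = 1 by omega] at h7
      have := Nat.dvd_one.1 h7
      omega
  · have h5 := sum_padicValNat_part_le hp5 h0 h1 (Finset.erase_subset j _) hE
    rw [mul_add, mul_add]
    rw [mul_add] at hb
    rcases hb with hb | ⟨hb, _⟩ <;> omega

lemma gam_eq_mul (v : ℕ →₀ ℕ) : gam v =
    (∏ i ∈ v.support, (i + 1) ^ v i) * ∏ i ∈ v.support, (v i).factorial :=
  Finset.prod_mul_distrib

lemma pow_dvd_pow_mul_factorial {p : ℕ} [hp : Fact p.Prime] (hp5 : 5 ≤ p) {v : ℕ →₀ ℕ}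
    {N s r b : ℕ} (hs : 0 < s) (hN : N + 2 ≤ s * (p - 2)) (hw : wt v = r * (p - 1))
    (hr : s + b + 1 ≤ r) (he : wt v + deg v ≤ p * b + p + 1) :
    p ^ (N + 1 + padicValNat p (gam v)) ∣ p ^ b * b.factorial := by
  have hP : ∏ i ∈ v.support, (i + 1) ^ v i ≠ 0 :=
    Finset.prod_ne_zero_iff.2 fun i _ => pow_ne_zero _ (Nat.succ_ne_zero _)
  have hF : ∏ i ∈ v.support, (v i).factorial ≠ 0 :=
    Finset.prod_ne_zero_iff.2 fun i _ => Nat.factorial_ne_zero _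
  rw [gam_eq_mul, padicValNat.mul hP hF]
  have hG : p * (p - 1) * padicValNat p (∏ i ∈ v.support, (i + 1) ^ v i) ≤
      wt v + deg v + p * (p - 2) * deg v := by
    rw [padicValNat_finset_prod _ _ fun i _ => pow_ne_zero _ (Nat.succ_ne_zero _), wt_add_deg,
      deg, Finsupp.sum, Finset.mul_sum, Finset.mul_sum, ← Finset.sum_add_distrib]
    refine Finset.sum_le_sum fun i _ => ?_
    rw [padicValNat.pow]
    have := Nat.mul_le_mul_right (v i) (mul_padicValNat_le (p := p) (Nat.succ_ne_zero i))
    calc p * (p - 1) * (v i * padicValNat p (i + 1))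
        = p * (p - 1) * padicValNat p (i + 1) * v i := by ring
      _ ≤ (i + 1 + p * (p - 2)) * v i := this
      _ = _ := by ring
  generalize padicValNat p (∏ i ∈ v.support, (i + 1) ^ v i) = G at *
  obtain ⟨q, hq⟩ : ∃ q, p = q + 5 := ⟨p - 5, by omega⟩
  have hq1 : p - 1 = q + 4 := by omega
  have hq2 : p - 2 = q + 3 := by omega
  rw [hq1, hq2] at hG
  rw [hq1] at hw
  rw [hq2] at hN
  rw [hw] at he hG
  rw [hq] at he hG
  have h1 : deg v + (q + 5) * s ≤ r + 1 := by nlinarith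
  have h2 : (q + 5) * (G + N + 1) + 2 ≤ r * (q + 4) + deg v := by
    have h3 : (q + 4) * ((q + 5) * (G + N + 1) + 2) ≤ (q + 4) * (r * (q + 4) + deg v) := by
      nlinarith [Nat.mul_le_mul_left ((q + 4) * (q + 5)) hN, Nat.mul_le_mul_left ((q + 3) * (q + 4)) h1]
    exact Nat.le_of_mul_le_mul_left h3 (by omega)
  have hbG : N + 1 + G ≤ b := by
    by_contra hcon
    nlinarith [Nat.mul_le_mul_left (q + 5) (show b + 1 ≤ N + 1 + G by omega)]
  have hdb : deg v ≤ b := by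
    by_contra hcon
    nlinarith [Nat.mul_le_mul_left (q + 5) (show b + 1 ≤ deg v by omega),
      Nat.mul_le_mul_left (q + 4) h1, Nat.mul_le_mul_left ((q + 4) * (q + 5)) hs]
  rw [← add_assoc, pow_add]
  refine mul_dvd_mul (pow_dvd_pow _ hbG) (pow_padicValNat_dvd.trans ?_)
  exact (Nat.prod_factorial_dvd_factorial_sum _ _).trans (Nat.factorial_dvd_factorial hdb)

lemma tau_add_single_mul_gam {p : ℕ} (hp : 0 < p) {v : ℕ →₀ ℕ} (h1 : v (p - 1) = 0)
    (he : 2 ≤ wt v + deg v) (k : ℕ) :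
    tau (v + single (p - 1) k) * gam v = (((-1) ^ (deg v + k - 1) *
      (p ^ ((wt v + deg v - 2) / p) * (k + 1).ascFactorial ((wt v + deg v - 2) / p) *
        primeToFactorial p (k * p + (wt v + deg v - 2)) : ℕ) : ℤ) : ℚ) := by
  have hA : wt v + (p - 1) * k + (deg v + k) - 2 = k * p + (wt v + deg v - 2) := by
    obtain ⟨q, rfl⟩ : ∃ q, p = q + 1 := ⟨p - 1, by omega⟩
    have : k * (q + 1) = q * k + k := by ring
    simp only [Nat.add_sub_cancel]
    omega
  have hdiv : (k * p + (wt v + deg v - 2)) / p = k + (wt v + deg v - 2) / p := by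
    rw [add_comm, Nat.add_mul_div_right _ _ hp, add_comm]
  have hgam : (gam v : ℚ) ≠ 0 := Nat.cast_ne_zero.2 (gam_ne_zero v)
  have hpq : (p : ℚ) ≠ 0 := Nat.cast_ne_zero.2 hp.ne'
  have hk : (k.factorial : ℚ) ≠ 0 := Nat.cast_ne_zero.2 k.factorial_ne_zero
  unfold tau
  rw [wt_add_single, deg_add_single, gam_add_single h1, hA,
    factorial_eq_pow_mul_primeToFactorial hp, hdiv, ← Nat.factorial_mul_ascFactorial,
    Nat.sub_add_cancel hp, pow_add]
  push_cast
  field_simp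

lemma le_pval_tau {p : ℕ} [hp : Fact p.Prime] (hp5 : 5 ≤ p) {v : ℕ →₀ ℕ} (h0 : v 0 = 0)
    (h1 : v (p - 1) = 0) (hv : v ≠ 0) {N l s k : ℕ} (hdvd : p ^ N ∣ l) (hs : 0 < s)
    (hN : N + 2 ≤ s * (p - 2)) (hk : k < l) (hw : wt v + k * (p - 1) = (s + l) * (p - 1)) :
    ((N + 1 : ℕ) : WithTop ℤ) ≤ pval p (tau (v + single (p - 1) k)) := by
  have he := mul_padicValNat_gam_add_two_le hp5 h0 h1 hv
  have hr : wt v = (s + (l - k)) * (p - 1) := by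
    obtain ⟨c, rfl⟩ : ∃ c, l = k + c := ⟨l - k, by omega⟩
    rw [Nat.add_sub_cancel_left]
    linarith
  refine le_pval_of_mul_eq (gam_ne_zero v) (tau_add_single_mul_gam hp.out.pos h1 (by omega) k)
    (Dvd.dvd.mul_left ?_ _)
  set b := (wt v + deg v - 2) / p with hb
  have hlt : wt v + deg v - 2 < p * b + p := by
    have : p * b + _ = _ := Nat.div_add_mod (wt v + deg v - 2) p
    have := Nat.mod_lt (wt v + deg v - 2) hp.out.pos
    omega
  suffices h : p ^ (N + 1 + padicValNat p (gam v)) ∣ p ^ b * (k + 1).ascFactorial b by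
    exact_mod_cast h.mul_right _
  rcases Nat.lt_or_ge (k + b) l with h | h
  · exact (pow_dvd_pow_mul_factorial hp5 hs hN hr (by omega) (by omega)).trans
      (mul_dvd_mul_left _ (Nat.factorial_dvd_ascFactorial _ _))
  · have hb1 : 1 ≤ b := by omega
    have hpb : p ≤ wt v + deg v - 2 := by
      by_contra hcon
      rw [Nat.div_eq_of_lt (by omega)] at hb
      omega
    have h2 := mul_padicValNat_gam_succ_add_two_le hp5 h0 h1 (hr ▸ Dvd.intro_left _ rfl) (by omega)
    have h3 : padicValNat p (gam v) + 1 ≤ b :=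
      (Nat.le_div_iff_mul_le hp.out.pos).2 (by rw [mul_comm]; omega)
    rw [show N + 1 + padicValNat p (gam v) = padicValNat p (gam v) + 1 + N by ring, pow_add]
    exact mul_dvd_mul (pow_dvd_pow _ h3) (hdvd.trans (dvd_ascFactorial hk h))

lemma le_pval_tau_sub_tau {p : ℕ} [hp : Fact p.Prime] (hp5 : 5 ≤ p) {v : ℕ →₀ ℕ} (h0 : v 0 = 0)
    (h1 : v (p - 1) = 0) (hv : v ≠ 0) {N l : ℕ} (k : ℕ) (hdvd : p ^ N ∣ l) (hw : p - 1 ∣ wt v) :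
    ((N + 1 : ℕ) : WithTop ℤ) ≤
      pval p (tau (v + single (p - 1) (k + l)) - tau (v + single (p - 1) k)) := by
  have he := mul_padicValNat_gam_add_two_le hp5 h0 h1 hv
  have hd : 1 ≤ deg v := by
    obtain ⟨i, hi⟩ := Finsupp.support_nonempty_iff.2 hv
    exact (Nat.pos_of_ne_zero (Finsupp.mem_support_iff.1 hi)).trans_le
      (Finset.single_le_sum (f := fun i => v i) (fun _ _ => Nat.zero_le _) hi)
  have heq : ∀ k, _ := tau_add_single_mul_gam hp.out.pos h1 (show 2 ≤ wt v + deg v by omega)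
  refine le_pval_of_mul_eq (gam_ne_zero v) (by rw [sub_mul, heq, heq, ← Int.cast_sub]) ?_
  have hU := primeToFactorial_add_mul hp.out (by omega) hdvd (k * p + (wt v + deg v - 2))
  rw [show k * p + (wt v + deg v - 2) + l * p = (k + l) * p + (wt v + deg v - 2) by ring] at hU
  set b := (wt v + deg v - 2) / p with hb
  have hasc : (p : ℤ) ^ N ∣ (k + l + 1).ascFactorial b - (k + 1).ascFactorial b := by
    have := ((ascFactorial_modEq k l b).of_dvd hdvd).symm.dvd
    exact_mod_cast this
  rw [show deg v + (k + l) - 1 = (deg v + k - 1) + l by omega, pow_add (-1 : ℤ)]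
  push_cast
  generalize (primeToFactorial p ((k + l) * p + (wt v + deg v - 2)) : ℤ) = U' at *
  generalize (primeToFactorial p (k * p + (wt v + deg v - 2)) : ℤ) = U at *
  rcases Nat.eq_zero_or_pos b with hb0 | hb1
  · have hg : padicValNat p (gam v) = 0 := by
      have := (Nat.div_eq_zero_iff_lt hp.out.pos).1 (hb.symm.trans hb0)
      by_contra hcon
      have := Nat.mul_le_mul_left p (Nat.pos_of_ne_zero hcon)
      omega
    rw [hg, hb0]
    simp only [add_zero, pow_zero, Nat.ascFactorial_zero, Nat.cast_one, one_mul]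
    exact (hU.mul_left ((-1) ^ (deg v + k - 1))).trans (dvd_of_eq (by ring))
  · have hpb : p ≤ wt v + deg v - 2 := by
      by_contra hcon
      rw [Nat.div_eq_of_lt (by omega)] at hb
      omega
    have h2 := mul_padicValNat_gam_succ_add_two_le hp5 h0 h1 hw (by omega)
    have h3 : padicValNat p (gam v) + 1 ≤ b :=
      (Nat.le_div_iff_mul_le hp.out.pos).2 (by rw [mul_comm]; omega)
    rw [show N + 1 + padicValNat p (gam v) = padicValNat p (gam v) + 1 + N by ring, pow_add]
    have h4 := mul_dvd_mul (pow_dvd_pow (p : ℤ) h3)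
      (((hasc.mul_left ((-1) ^ l * U')).add
        (((pow_dvd_pow _ (Nat.le_succ N)).trans hU).mul_left
          ((k + 1).ascFactorial b : ℤ))))
    exact (h4.mul_left ((-1) ^ (deg v + k - 1))).trans (dvd_of_eq (by ring))

lemma sum_toMultiset (u : ℕ →₀ ℕ) : (Finsupp.toMultiset u).sum = wt u := by
  rw [Finsupp.toMultiset_apply, wt, Finsupp.sum, Finsupp.sum,
    ← Multiset.coe_sumAddMonoidHom, map_sum]
  exact Finset.sum_congr rfl fun i _ => by simp [Multiset.sum_nsmul, mul_comm]

lemma coeff_divB (n : ℕ) (u : ℕ →₀ ℕ) :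
    coeff u (divB n) = if wt u = n ∧ u 0 = 0 then tau u else 0 := by
  classical
  unfold divB
  simp only [coeff_sum, coeff_smul, coeff_monomial, smul_eq_mul, mul_ite, mul_one, mul_zero]
  split_ifs with h
  · have hpos : ∀ {i}, i ∈ Finsupp.toMultiset u → 0 < i := by
      intro i hi
      rw [Finsupp.mem_toMultiset, Finsupp.mem_support_iff] at hi
      exact Nat.pos_of_ne_zero fun h' => hi (h' ▸ h.2)
    rw [Finset.sum_eq_single (⟨Finsupp.toMultiset u, hpos, by rw [sum_toMultiset, h.1]⟩ :
      n.Partition)]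
    · simp
    · intro P _ hP
      rw [if_neg]
      intro hPu
      apply hP
      ext1
      simp [← hPu]
    · simp
  · refine Finset.sum_eq_zero fun P _ => if_neg ?_
    rintro rfl
    refine h ⟨?_, ?_⟩
    · rw [← sum_toMultiset, Multiset.toFinsupp_toMultiset, P.parts_sum]
    · rw [Multiset.toFinsupp_apply, Multiset.count_eq_zero]
      exact fun h0 => lt_irrefl 0 (P.parts_pos h0)

/-- universal Kummer congruence mod p^{N+1} for p ≥ 5,
n = m + l(p−1), m = s(p−1), p^N ∣ l, s ≥ ⌈(N+2)/(p−2)⌉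
(the latter expressed equivalently as N+2 ≤ s(p−2)).
σ(n) is the partition of n all of whose parts equal p−1. -/
theorem stmt_3 (p : ℕ) (hp : p.Prime) (hp5 : 5 ≤ p) (N l s : ℕ)
    (hl : 0 < l) (hdvd : p ^ N ∣ l) (hs : 0 < s) (hceil : N + 2 ≤ s * (p - 2))
    (m n : ℕ) (hm : m = s * (p - 1)) (hn : n = m + l * (p - 1)) :
    PCong p (N + 1) (divB n)
      ((X (p - 1)) ^ l * divB m
        + C (tau (Finsupp.single (p - 1) (l + s)) - tau (Finsupp.single (p - 1) s))
          * (X (p - 1)) ^ (l + s)) := by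
  classical
  have : Fact p.Prime := ⟨hp⟩
  have hp1 : 0 < p - 1 := by omega
  intro u
  obtain ⟨v, k, h1, rfl⟩ : ∃ v k, v (p - 1) = 0 ∧ u = v + single (p - 1) k :=
    ⟨u.erase (p - 1), u (p - 1), by simp, (Finsupp.erase_add_single _ _).symm⟩
  rw [coeff_sub, coeff_add, X_pow_eq_monomial, X_pow_eq_monomial, coeff_monomial_mul',
    coeff_C_mul, coeff_monomial, coeff_divB, coeff_divB, wt_add_single, one_mul]
  have hle : single (p - 1) l ≤ v + single (p - 1) k ↔ l ≤ k := by
    rw [Finsupp.single_le_iff]; simp [h1]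
  have hsub : v + single (p - 1) k - single (p - 1) l = v + single (p - 1) (k - l) := by
    ext i
    by_cases hi : i = p - 1
    · subst hi; simp [h1]
    · simp [Finsupp.single_eq_of_ne hi]
  have h00 : ∀ j, (v + single (p - 1) j : ℕ →₀ ℕ) 0 = v 0 := fun j => by
    simp [Finsupp.single_eq_of_ne hp1.ne]
  have hsing : single (p - 1) (l + s) = v + single (p - 1) k ↔ v = 0 ∧ k = l + s := by
    constructor
    · intro h
      have hk : k = l + s := by simpa [h1] using (DFunLike.congr_fun h (p - 1)).symm
      exact ⟨by rw [hk] at h; simpa using h, hk⟩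
    · rintro ⟨rfl, rfl⟩; simp
  simp only [hle, hsub, h00, hsing, wt_add_single]
  have hwn : l ≤ k → (wt v + (p - 1) * (k - l) = m ↔ wt v + (p - 1) * k = n) := by
    intro hlk
    obtain ⟨c, rfl⟩ := Nat.exists_eq_add_of_le hlk
    rw [Nat.add_sub_cancel_left, hn, mul_add, mul_comm l]
    omega
  have htop : ((N + 1 : ℕ) : WithTop ℤ) ≤ pval p 0 := by simp [pval]
  by_cases hv : v = 0
  · subst hv
    have hwt0 : wt 0 = 0 := rfl
    have hk : (p - 1) * k = n ↔ k = l + s := by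
      rw [hn, hm, ← add_mul, mul_comm, Nat.mul_left_inj hp1.ne', add_comm s]
    simp only [zero_add, Finsupp.coe_zero, Pi.zero_apply, and_true, true_and, hwt0] at hwn ⊢
    by_cases hkl : k = l + s
    · subst hkl
      have hms : (p - 1) * s = m := by rw [hm, mul_comm]
      simpa [hk, hms] using htop
    · by_cases hlk : l ≤ k
      · simpa [hk, hwn hlk, hkl, hlk] using htop
      · simpa [hk, hkl, hlk] using htop
  · simp only [hv, false_and, if_false, mul_zero, add_zero]
    by_cases hc : wt v + (p - 1) * k = n ∧ v 0 = 0
    · rw [if_pos hc]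
      obtain ⟨hc, h0⟩ := hc
      by_cases hlk : l ≤ k
      · rw [if_pos hlk, if_pos ⟨(hwn hlk).2 hc, h0⟩]
        obtain ⟨c, rfl⟩ := Nat.exists_eq_add_of_le hlk
        rw [Nat.add_sub_cancel_left, add_comm l c]
        refine le_pval_tau_sub_tau hp5 h0 h1 hv c hdvd ?_
        rw [hn, hm] at hc
        have hdn : p - 1 ∣ s * (p - 1) + l * (p - 1) :=
          dvd_add (Dvd.intro_left _ rfl) (Dvd.intro_left _ rfl)
        exact (Nat.dvd_add_left (Dvd.intro _ rfl)).1 (hc ▸ hdn)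
      · rw [if_neg hlk, sub_zero]
        refine le_pval_tau hp5 h0 h1 hv hdvd hs hceil (not_le.1 hlk) ?_
        rw [mul_comm k, hc, hn, hm]; ring
    · rw [if_neg hc]
      by_cases hlk : l ≤ k
      · rw [if_pos hlk, if_neg fun h => hc ⟨(hwn hlk).1 h.1, h.2⟩]
        simpa using htop
      · rw [if_neg hlk]
        simpa using htop

end
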